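/- For every integer d ≥ 1 and all nonzero vectors U1, U2, U3 ∈ ℝ^d, one has ∫_{S^{d−1}} 1(⟨β,U1⟩ ≤ 0)·1(⟨β,U2⟩ ≤ 0)·1(⟨β,U3⟩ ≤ 0) dλ(β) = 1/2 − (1/(4π))·[Ang(U1,U2) + Ang(U1,U3) + Ang(U2,U3)]. -/

import Mathlib

open MeasureTheory ProbabilityTheory Real
open scoped RealInnerProductSpace ENNReal BigOperators

noncomputable section

/-- The standard Gaussian measure on `ℝ^d = EuclideanSpace ℝ (Fin d)`. -/
def stdGaussian (d : ℕ) : Measure (EuclideanSpace ℝ (Fin d)) :=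
  (Measure.pi fun _ : Fin d => gaussianReal 0 1).map
    ⇑(EuclideanSpace.equiv (Fin d) ℝ).symm

/-- The uniform (rotation-invariant) probability measure `λ` on the unit sphere
`S^{d-1} = {x : ‖x‖ = 1} ⊆ ℝ^d`, realized as a Borel measure on `ℝ^d` concentrated
on the sphere: the pushforward of the standard Gaussian under `x ↦ ‖x‖⁻¹ • x`. -/
def sphereUniform (d : ℕ) : Measure (EuclideanSpace ℝ (Fin d)) :=
  (stdGaussian d).map fun x => ‖x‖⁻¹ • x

/-- `Ang u v = arccos (⟪u,v⟫ / (‖u‖ ‖v‖)) ∈ [0, π]`, the angle between two nonzero vectors. -/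
def Ang {d : ℕ} (u v : EuclideanSpace ℝ (Fin d)) : ℝ :=
  Real.arccos (⟪u, v⟫ / (‖u‖ * ‖v‖))

/-- Radial constant in the polar decomposition of the planar Gaussian. -/
def radK : ℝ := ∫ r in Set.Ioi (0 : ℝ), r * ((√(2 * π))⁻¹ ^ 2 * rexp (-(r ^ 2) / 2))

lemma gauss_sector (S : Set (ℝ × ℝ)) (T : Set ℝ) (hS : MeasurableSet S) (hT : MeasurableSet T)
    (h : ∀ r φ : ℝ, 0 < r → φ ∈ Set.Ioo (-π) π → ((r * cos φ, r * sin φ) ∈ S ↔ φ ∈ T)) :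
    ((gaussianReal 0 1).prod (gaussianReal 0 1)).real S
      = radK * volume.real (Set.Ioo (-π) π ∩ T) := by
  have h1 : (1 : NNReal) ≠ 0 := one_ne_zero
  have hd : (gaussianReal 0 1).prod (gaussianReal 0 1) =
      (volume : Measure (ℝ × ℝ)).withDensity
        (fun z => ENNReal.ofReal (gaussianPDFReal 0 1 z.1 * gaussianPDFReal 0 1 z.2)) := by
    rw [gaussianReal_of_var_ne_zero _ h1, prod_withDensity (by fun_prop) (by fun_prop)]
    congr 1
    ext z
    simp only [gaussianPDF]
    rw [ENNReal.ofReal_mul (gaussianPDFReal_nonneg _ _ _)]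
  have hI : ((gaussianReal 0 1).prod (gaussianReal 0 1)).real S
      = ∫ z, S.indicator (fun z : ℝ × ℝ => gaussianPDFReal 0 1 z.1 * gaussianPDFReal 0 1 z.2) z := by
    rw [← integral_indicator_one hS, hd, integral_withDensity_eq_integral_toReal_smul]
    · congr 1
      ext z
      rw [ENNReal.toReal_ofReal (mul_nonneg (gaussianPDFReal_nonneg _ _ _) (gaussianPDFReal_nonneg _ _ _))]
      by_cases hz : z ∈ S <;> simp [hz]
    · fun_prop
    · exact ae_of_all _ fun z => ENNReal.ofReal_lt_top
  rw [hI, ← integral_comp_polarCoord_symm, polarCoord_target]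
  have : ∀ p ∈ (Set.Ioi (0:ℝ)) ×ˢ (Set.Ioo (-π) π), p.1 • S.indicator (fun z : ℝ × ℝ => gaussianPDFReal 0 1 z.1 * gaussianPDFReal 0 1 z.2) (polarCoord.symm p)
     = (p.1 * ((√(2 * π))⁻¹ ^ 2 * rexp (-(p.1 ^ 2) / 2))) * T.indicator 1 p.2 := by
    rintro ⟨r, φ⟩ ⟨hr, hφ⟩
    have := h r φ hr hφ
    simp only [polarCoord_symm_apply]
    by_cases hz : φ ∈ T
    · rw [Set.indicator_of_mem (this.2 hz), Set.indicator_of_mem hz]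
      simp only [gaussianPDFReal, NNReal.coe_one, mul_one, sub_zero, smul_eq_mul, Pi.one_apply]
      have : rexp (-(r ^ 2) / 2) = rexp (-(r * cos φ) ^ 2 / 2) * rexp (-(r * sin φ) ^ 2 / 2) := by
        rw [← Real.exp_add]
        congr 1
        have := sin_sq_add_cos_sq φ
        linear_combination (r^2/2) * this
      rw [this]
      ring
    · rw [Set.indicator_of_notMem (fun hh => hz (this.1 hh)), Set.indicator_of_notMem hz]
      simp
  rw [setIntegral_congr_fun (measurableSet_Ioi.prod measurableSet_Ioo) this]
  rw [Measure.volume_eq_prod, setIntegral_prod_mul (fun r => r * ((√(2 * π))⁻¹ ^ 2 * rexp (-(r ^ 2) / 2))) (T.indicator 1)]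
  rw [integral_indicator_one hT, measureReal_restrict_apply hT, Set.inter_comm]
  rfl

lemma radK_eq : radK = 1 / (2 * π) := by
  have := gauss_sector Set.univ Set.univ .univ .univ (by simp)
  have hp := pi_pos
  rw [Set.inter_univ, probReal_univ, Real.volume_real_Ioo_of_le (by linarith)] at this
  field_simp
  linarith

lemma gauss_wedge (θ : ℝ) (h0 : 0 ≤ θ) (hπ : θ ≤ π) :
    ((gaussianReal 0 1).prod (gaussianReal 0 1)).real
      {p | 0 < p.1 ∧ 0 < cos θ * p.1 + sin θ * p.2} = 1 / 2 - θ / (2 * π) := by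
  have hp := pi_pos
  rw [gauss_sector _ (Set.Ioo (θ - π / 2) (π / 2)) ?_ measurableSet_Ioo, radK_eq,
    Set.inter_eq_right.2, Real.volume_real_Ioo_of_le (by linarith)]
  · field_simp
    ring
  · intro x hx
    exact ⟨by linarith [hx.1], by linarith [hx.2]⟩
  · intro r φ hr hφ
    simp only [Set.mem_ofPred_eq, Set.mem_Ioo]
    have e : cos θ * (r * cos φ) + sin θ * (r * sin φ) = r * cos (φ - θ) := by
      rw [cos_sub]; ring
    rw [e, mul_pos_iff_of_pos_left hr, mul_pos_iff_of_pos_left hr]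
    constructor
    · rintro ⟨ha, hb⟩
      have h1 : φ < π / 2 := by
        by_contra hc
        exact absurd ha (not_lt.2 (cos_nonpos_of_pi_div_two_le_of_le (by linarith) (by linarith [hφ.2])))
      have h2 : -(π / 2) < φ := by
        by_contra hc
        rw [← cos_neg] at ha
        exact absurd ha (not_lt.2 (cos_nonpos_of_pi_div_two_le_of_le (by linarith) (by linarith [hφ.1])))
      refine ⟨?_, h1⟩
      by_contra hc
      rw [← cos_neg] at hb
      exact absurd hb (not_lt.2 (cos_nonpos_of_pi_div_two_le_of_le (by linarith) (by linarith [hφ.1])))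
    · rintro ⟨ha, hb⟩
      exact ⟨cos_pos_of_mem_Ioo ⟨by linarith, hb⟩, cos_pos_of_mem_Ioo ⟨by linarith, by linarith⟩⟩
  · rw [Set.ofPred_and]
    exact (measurableSet_lt (by fun_prop) (by fun_prop)).inter
      (measurableSet_lt (by fun_prop) (by fun_prop))

lemma stdG_eq (d : ℕ) :
    _root_.stdGaussian d = ProbabilityTheory.stdGaussian (EuclideanSpace ℝ (Fin d)) := by
  rw [← map_pi_eq_stdGaussian]
  rfl

instance (d : ℕ) : IsProbabilityMeasure (_root_.stdGaussian d) := by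
  rw [stdG_eq]; infer_instance

lemma law_eq {d : ℕ} (u v : EuclideanSpace ℝ (Fin d)) (c s : ℝ) (hu : ‖u‖ = 1) (hv : ‖v‖ = 1)
    (hc : ⟪u, v⟫ = c) (hs : c ^ 2 + s ^ 2 = 1) :
    (_root_.stdGaussian d).map (fun x => (⟪u, x⟫, ⟪v, x⟫)) =
      ((gaussianReal 0 1).prod (gaussianReal 0 1)).map (fun p => (p.1, c * p.1 + s * p.2)) := by
  let A : EuclideanSpace ℝ (Fin d) →L[ℝ] ℝ × ℝ := (innerSL ℝ u).prod (innerSL ℝ v)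
  let B : ℝ × ℝ →L[ℝ] ℝ × ℝ := (ContinuousLinearMap.fst ℝ ℝ ℝ).prod
    (c • ContinuousLinearMap.fst ℝ ℝ ℝ + s • ContinuousLinearMap.snd ℝ ℝ ℝ)
  change (_root_.stdGaussian d).map A = ((gaussianReal 0 1).prod (gaussianReal 0 1)).map B
  rw [stdG_eq]
  apply Measure.ext_of_charFunDual
  ext L
  have hL : ∀ x y : ℝ, L (x, y) = x * L (1, 0) + y * L (0, 1) := by
    intro x y
    have : ((x, y) : ℝ × ℝ) = x • (1, 0) + y • (0, 1) := by simp
    rw [this, map_add, map_smul, map_smul]; rfl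
  have hreal : ∀ M : StrongDual ℝ ℝ, charFunDual (gaussianReal 0 1) M
      = Complex.exp (- ((M 1 ^ 2 / 2 : ℝ) : ℂ)) := by
    intro M
    have : charFunDual (gaussianReal 0 1) M = charFun (gaussianReal 0 1) (M 1) := by
      rw [charFunDual_apply, charFun_apply]
      congr 1
      ext x
      have : M x = x * M 1 := by
        conv_lhs => rw [← mul_one x, ← smul_eq_mul, map_smul, smul_eq_mul]
      simp [this, mul_comm]
    rw [this, charFun_gaussianReal]
    congr 1
    push_cast
    simp
  have hA : L.comp A = innerSL ℝ (L (1, 0) • u + L (0, 1) • v) := by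
    ext x
    change L (⟪u, x⟫, ⟪v, x⟫) = _
    rw [hL]
    simp [inner_add_left, inner_smul_left, mul_comm]
  rw [charFunDual_map, charFunDual_map, charFunDual_prod, charFunDual_stdGaussian, hreal, hreal, hA,
    innerSL_apply_norm, ← Complex.exp_add]
  congr 1
  have e1 : (L.comp B).comp (.inl ℝ ℝ ℝ) 1 = L (1, 0) + c * L (0, 1) := by
    change L (1, c * 1 + s * 0) = _
    rw [hL]; ring
  have e2 : (L.comp B).comp (.inr ℝ ℝ ℝ) 1 = s * L (0, 1) := by
    change L (0, c * 0 + s * 1) = _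
    rw [hL]; ring
  rw [e1, e2]
  have e3 : ‖L (1, 0) • u + L (0, 1) • v‖ ^ 2 =
      (L (1, 0) + c * L (0, 1)) ^ 2 + (s * L (0, 1)) ^ 2 := by
    rw [norm_add_sq_real, norm_smul, norm_smul, inner_smul_left, inner_smul_right, hu, hv, hc]
    simp only [Real.norm_eq_abs, mul_one, sq_abs]
    simp
    linear_combination - (L (0, 1)) ^ 2 * hs
  norm_cast
  rw [e3]
  push_cast
  ring

lemma pair_unit {d : ℕ} (u v : EuclideanSpace ℝ (Fin d)) (hu : ‖u‖ = 1) (hv : ‖v‖ = 1) :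
    (_root_.stdGaussian d).real {x | 0 < ⟪u, x⟫ ∧ 0 < ⟪v, x⟫} = 1 / 2 - arccos ⟪u, v⟫ / (2 * π) := by
  have hm : |⟪u, v⟫| ≤ 1 := by
    have := abs_real_inner_le_norm u v
    rwa [hu, hv, mul_one] at this
  have hcos : cos (arccos ⟪u, v⟫) = ⟪u, v⟫ := cos_arccos (abs_le.1 hm).1 (abs_le.1 hm).2
  have hl := law_eq u v (cos (arccos ⟪u, v⟫)) (sin (arccos ⟪u, v⟫)) hu hv hcos.symm
    (cos_sq_add_sin_sq _)
  have hQ : MeasurableSet {p : ℝ × ℝ | 0 < p.1 ∧ 0 < p.2} := by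
    rw [Set.ofPred_and]
    exact (measurableSet_lt (by fun_prop) (by fun_prop)).inter
      (measurableSet_lt (by fun_prop) (by fun_prop))
  have := congrArg (fun μ => μ.real {p : ℝ × ℝ | 0 < p.1 ∧ 0 < p.2}) hl
  rw [map_measureReal_apply (by fun_prop) hQ, map_measureReal_apply (by fun_prop) hQ] at this
  exact this.trans (gauss_wedge _ (arccos_nonneg _) (arccos_le_pi _))

lemma pair {d : ℕ} (u v : EuclideanSpace ℝ (Fin d)) (hu : u ≠ 0) (hv : v ≠ 0) :
    (_root_.stdGaussian d).real {x | 0 < ⟪x, u⟫ ∧ 0 < ⟪x, v⟫} = 1 / 2 - Ang u v / (2 * π) := by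
  have hu' := norm_pos_iff.2 hu
  have hv' := norm_pos_iff.2 hv
  have := pair_unit (‖u‖⁻¹ • u) (‖v‖⁻¹ • v) (by rw [norm_smul]; simp [hu]) (by rw [norm_smul]; simp [hv])
  simp only [inner_smul_left, inner_smul_right] at this
  simp only [RCLike.conj_to_real, mul_pos_iff_of_pos_left (inv_pos.2 hu'),
    mul_pos_iff_of_pos_left (inv_pos.2 hv')] at this
  simp only [real_inner_comm u, real_inner_comm v]
  rw [this, Ang]
  congr 3
  rw [real_inner_comm]
  field_simp

lemma single {d : ℕ} (u : EuclideanSpace ℝ (Fin d)) (hu : u ≠ 0) :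
    (_root_.stdGaussian d).real {x | 0 < ⟪x, u⟫} = 1 / 2 := by
  have := pair u u hu hu
  simp only [and_self] at this
  have hu' := norm_pos_iff.2 hu
  rw [this, Ang, real_inner_self_eq_norm_mul_norm, div_self (by positivity), arccos_one]
  simp

lemma stdG_neg (d : ℕ) : (_root_.stdGaussian d).map (fun x => -x) = _root_.stdGaussian d := by
  rw [stdG_eq]
  exact stdGaussian_map (LinearIsometryEquiv.neg ℝ)

lemma real_neg {d : ℕ} {S : Set (EuclideanSpace ℝ (Fin d))} (hS : MeasurableSet S) :
    (_root_.stdGaussian d).real {x | -x ∈ S} = (_root_.stdGaussian d).real S := by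
  conv_rhs => rw [← stdG_neg, map_measureReal_apply (by fun_prop) hS]
  rfl

lemma meas_pos {d : ℕ} (u : EuclideanSpace ℝ (Fin d)) : MeasurableSet {x | 0 < ⟪x, u⟫} :=
  measurableSet_lt (by fun_prop) (by fun_prop)

lemma null_hyp {d : ℕ} (u : EuclideanSpace ℝ (Fin d)) (hu : u ≠ 0) :
    ∀ᵐ x ∂(_root_.stdGaussian d), ⟪x, u⟫ ≠ 0 := by
  have h1 := single u hu
  have h2 := real_neg (meas_pos u)
  simp only [Set.mem_ofPred_eq, inner_neg_left, Left.neg_pos_iff] at h2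
  have h3 : (_root_.stdGaussian d).real ({x | 0 < ⟪x, u⟫} ∪ {x | ⟪x, u⟫ < 0}) = 1 := by
    rw [measureReal_union _ (measurableSet_lt (by fun_prop) (by fun_prop)), h2, h1]
    · norm_num
    · rw [Set.disjoint_left]
      intro x hx hy
      rw [Set.mem_ofPred_eq] at hx hy
      exact lt_asymm hx hy
  have h4 : (_root_.stdGaussian d).real ({x | 0 < ⟪x, u⟫} ∪ {x | ⟪x, u⟫ < 0})ᶜ = 0 := by
    rw [probReal_compl_eq_one_sub ((meas_pos u).union (measurableSet_lt (by fun_prop) (by fun_prop))), h3]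
    simp
  rw [measureReal_eq_zero_iff] at h4
  rw [ae_iff]
  refine measure_mono_null ?_ h4
  intro x hx
  simp only [ne_eq, not_not, Set.mem_ofPred_eq] at hx
  simp [hx]

/-- for `d ≥ 1` and nonzero `U₁, U₂, U₃ ∈ ℝ^d`,
`∫_{S^{d-1}} 1(⟪β,U₁⟫ ≤ 0)·1(⟪β,U₂⟫ ≤ 0)·1(⟪β,U₃⟫ ≤ 0) dλ(β)
  = 1/2 - (Ang(U₁,U₂) + Ang(U₁,U₃) + Ang(U₂,U₃))/(4π)`. -/
theorem stmt1 {d : ℕ} (hd : 1 ≤ d) (U1 U2 U3 : EuclideanSpace ℝ (Fin d))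
    (h1 : U1 ≠ 0) (h2 : U2 ≠ 0) (h3 : U3 ≠ 0) :
    (∫ β, (if ⟪β, U1⟫ ≤ 0 then (1 : ℝ) else 0) * (if ⟪β, U2⟫ ≤ 0 then (1 : ℝ) else 0)
        * (if ⟪β, U3⟫ ≤ 0 then (1 : ℝ) else 0) ∂(sphereUniform d))
      = 1 / 2 - (1 / (4 * π)) * (Ang U1 U2 + Ang U1 U3 + Ang U2 U3) := by
  have p12 := pair U1 U2 h1 h2
  have p13 := pair U1 U3 h1 h3
  have p23 := pair U2 U3 h2 h3
  have s1 := single U1 h1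
  have s2 := single U2 h2
  have s3 := single U3 h3
  have n1 := null_hyp U1 h1
  have n2 := null_hyp U2 h2
  have n3 := null_hyp U3 h3
  have m1 := meas_pos U1
  have m2 := meas_pos U2
  have m3 := meas_pos U3
  have hneg := real_neg ((m1.inter m2).inter m3)
  set G := _root_.stdGaussian d with hG
  -- reduce to the Gaussian
  have hmeas : ∀ U : EuclideanSpace ℝ (Fin d),
      Measurable (fun β : EuclideanSpace ℝ (Fin d) => if ⟪β, U⟫ ≤ 0 then (1 : ℝ) else 0) :=
    fun U => Measurable.ite (measurableSet_le (by fun_prop) (by fun_prop)) measurable_const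
      measurable_const
  have hnorm : Measurable (fun x : EuclideanSpace ℝ (Fin d) => ‖x‖⁻¹ • x) := by fun_prop
  have hm3 : Measurable (fun β : EuclideanSpace ℝ (Fin d) => (if ⟪β, U1⟫ ≤ 0 then (1 : ℝ) else 0) *
      (if ⟪β, U2⟫ ≤ 0 then (1 : ℝ) else 0) * (if ⟪β, U3⟫ ≤ 0 then (1 : ℝ) else 0)) :=
    ((hmeas U1).mul (hmeas U2)).mul (hmeas U3)
  rw [sphereUniform, integral_map hnorm.aemeasurable hm3.aestronglyMeasurable]
  have hsc : ∀ U x : EuclideanSpace ℝ (Fin d), ⟪x, U⟫ ≠ 0 →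
      (if ⟪‖x‖⁻¹ • x, U⟫ ≤ 0 then (1 : ℝ) else 0)
        = 1 - ({x | 0 < ⟪x, U⟫} : Set (EuclideanSpace ℝ (Fin d))).indicator 1 x := by
    intro U x hx
    have hx0 : x ≠ 0 := by rintro rfl; simp at hx
    have hp : 0 < ‖x‖⁻¹ := inv_pos.2 (norm_pos_iff.2 hx0)
    rw [real_inner_smul_left]
    by_cases h : 0 < ⟪x, U⟫
    · have := mul_pos hp h
      simp [h, this]
    · have := mul_nonpos_of_nonneg_of_nonpos hp.le (not_lt.1 h)
      simp [h, this]
  have hsc' : ∀ U x : EuclideanSpace ℝ (Fin d), ⟪x, U⟫ ≠ 0 →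
      ({x | 0 < ⟪-x, U⟫} : Set (EuclideanSpace ℝ (Fin d))).indicator 1 x
        = 1 - ({x | 0 < ⟪x, U⟫} : Set (EuclideanSpace ℝ (Fin d))).indicator (1 : EuclideanSpace ℝ (Fin d) → ℝ) x := by
    intro U x hx
    rcases lt_or_gt_of_ne hx with h | h
    · simp [h, h.le, not_lt.2]
    · simp [h, h.le, not_lt.2]
  set A1 := {x | 0 < ⟪x, U1⟫} with hA1
  set A2 := {x | 0 < ⟪x, U2⟫} with hA2
  set A3 := {x | 0 < ⟪x, U3⟫} with hA3
  have hI : ∀ S : Set (EuclideanSpace ℝ (Fin d)), MeasurableSet S →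
      Integrable (S.indicator (1 : EuclideanSpace ℝ (Fin d) → ℝ)) G := fun S hS =>
    (integrable_const (1 : ℝ)).indicator hS
  have m12 := m1.inter m2
  have m13 := m1.inter m3
  have m23 := m2.inter m3
  have m123 := m12.inter m3
  have key : ∫ x, (1 - A1.indicator 1 x) * (1 - A2.indicator 1 x) * (1 - A3.indicator (1 : EuclideanSpace ℝ (Fin d) → ℝ) x) ∂G
      = 1 - G.real A1 - G.real A2 - G.real A3 + G.real (A1 ∩ A2) + G.real (A1 ∩ A3)
        + G.real (A2 ∩ A3) - G.real (A1 ∩ A2 ∩ A3) := by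
    have : ∀ x, (1 - A1.indicator 1 x) * (1 - A2.indicator 1 x) * (1 - A3.indicator (1 : EuclideanSpace ℝ (Fin d) → ℝ) x)
       = 1 - A1.indicator 1 x - A2.indicator 1 x - A3.indicator 1 x + (A1 ∩ A2).indicator 1 x
        + (A1 ∩ A3).indicator 1 x + (A2 ∩ A3).indicator 1 x - (A1 ∩ A2 ∩ A3).indicator 1 x := by
      intro x
      simp only [Set.inter_indicator_one, Pi.mul_apply]
      ring
    simp_rw [this]
    have i1 := hI _ m1
    have i2 := hI _ m2
    have i3 := hI _ m3
    have i12 := hI _ m12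
    have i13 := hI _ m13
    have i23 := hI _ m23
    have i123 := hI _ m123
    have i0 : Integrable (fun _ => (1 : ℝ)) G := integrable_const _
    rw [integral_sub (by fun_prop) (by fun_prop), integral_add (by fun_prop) (by fun_prop),
      integral_add (by fun_prop) (by fun_prop), integral_add (by fun_prop) (by fun_prop),
      integral_sub (by fun_prop) (by fun_prop), integral_sub (by fun_prop) (by fun_prop),
      integral_sub (by fun_prop) (by fun_prop), integral_indicator_one m1,
      integral_indicator_one m2, integral_indicator_one m3, integral_indicator_one m12,
      integral_indicator_one m13, integral_indicator_one m23, integral_indicator_one m123]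
    simp
  have keyneg : G.real (A1 ∩ A2 ∩ A3) =
      ∫ x, (1 - A1.indicator 1 x) * (1 - A2.indicator 1 x) * (1 - A3.indicator (1 : EuclideanSpace ℝ (Fin d) → ℝ) x) ∂G := by
    have mneg : MeasurableSet {x | -x ∈ A1 ∩ A2 ∩ A3} := measurable_neg m123
    rw [← hneg, ← integral_indicator_one mneg]
    apply integral_congr_ae
    filter_upwards [n1, n2, n3] with x x1 x2 x3
    rw [← hsc' U1 x x1, ← hsc' U2 x x2, ← hsc' U3 x x3]
    change ({x | 0 < ⟪-x, U1⟫} ∩ {x | 0 < ⟪-x, U2⟫} ∩ {x | 0 < ⟪-x, U3⟫}).indicator 1 x = _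
    simp only [Set.inter_indicator_one, Pi.mul_apply]
  have goal1 : ∫ x, (if ⟪‖x‖⁻¹ • x, U1⟫ ≤ 0 then (1 : ℝ) else 0) *
      (if ⟪‖x‖⁻¹ • x, U2⟫ ≤ 0 then (1 : ℝ) else 0) *
      (if ⟪‖x‖⁻¹ • x, U3⟫ ≤ 0 then (1 : ℝ) else 0) ∂G =
      ∫ x, (1 - A1.indicator 1 x) * (1 - A2.indicator 1 x) * (1 - A3.indicator (1 : EuclideanSpace ℝ (Fin d) → ℝ) x) ∂G := by
    apply integral_congr_ae
    filter_upwards [n1, n2, n3] with x x1 x2 x3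
    rw [hsc U1 x x1, hsc U2 x x2, hsc U3 x x3]
  rw [goal1]
  change G.real (A1 ∩ A2) = _ at p12
  change G.real (A1 ∩ A3) = _ at p13
  change G.real (A2 ∩ A3) = _ at p23
  rw [keyneg, s1, s2, s3, p12, p13, p23] at key
  have e : 1 / (4 * π) * (Ang U1 U2 + Ang U1 U3 + Ang U2 U3) =
      (Ang U1 U2 / (2 * π) + Ang U1 U3 / (2 * π) + Ang U2 U3 / (2 * π)) / 2 := by
    have := pi_pos
    field_simp
    ring
  rw [e]
  linarith
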